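/- Let d ≥ 2, let γ be defined by 1/γ = 1/2 + 1/d, let 1 ≤ p ≤ γ, let s > d/p, and let r > s be an integer. Then there exist constants C₀ > 0 and c > 0, depending only on d, s, p, r, such that for every natural number k and every finite set X ⊂ (0,1)^d with |X| = 2^(kd) =: m̃, there exist a continuous function η : ℝ^d → [0,∞), supported in [0,1]^d and vanishing at every point of X, satisfying ‖η‖_{L^p(ℝ^d)} + sup_{t>0} t^(−s)·ω_r(η,t)_p ≤ C₀, and a continuously differentiable function v : ℝ^d → [0,∞), compactly supported in (0,1)^d and satisfying ‖ |∇v| ‖_{L²(ℝ^d)} ≤ 1, such that ∫_{ℝ^d} η(x)·v(x) dx ≥ c · m̃^(−(s/d − 1/p + 1/γ)). -/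

import Mathlib

open MeasureTheory ENNReal

/-- The `r`-th forward finite difference `Δ_h^r f(x) = Σ_{j=0}^r (−1)^(r−j) C(r,j) f(x + j h)`. -/
noncomputable def finDiffOp (d : ℕ) (r : ℕ) (h : EuclideanSpace ℝ (Fin d))
    (f : EuclideanSpace ℝ (Fin d) → ℝ) (x : EuclideanSpace ℝ (Fin d)) : ℝ :=
  ∑ j ∈ Finset.range (r + 1), (-1 : ℝ) ^ (r - j) * (r.choose j : ℝ) * f (x + (j : ℝ) • h)

/-- The modulus of smoothness `ω_r(f,t)_p = sup_{|h| ≤ t} ‖Δ_h^r f‖_{L^p(ℝ^d)}`,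
with values in `[0,∞]`. -/
noncomputable def modulus (d r : ℕ) (f : EuclideanSpace ℝ (Fin d) → ℝ)
    (p : ℝ≥0∞) (t : ℝ) : ℝ≥0∞ :=
  ⨆ (h : EuclideanSpace ℝ (Fin d)) (_ : ‖h‖ ≤ t),
    eLpNorm (finDiffOp d r h f) p volume

/-- The Besov `B^s_{p,∞}` seminorm `sup_{t>0} t^(−s) ω_r(f,t)_p`, valued in `[0,∞]`. -/
noncomputable def besovSeminorm (d r : ℕ) (s : ℝ) (p : ℝ≥0∞)
    (f : EuclideanSpace ℝ (Fin d) → ℝ) : ℝ≥0∞ :=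
  ⨆ (t : ℝ) (_ : 0 < t), ENNReal.ofReal (t ^ (-s)) * modulus d r f p t


/-- Iterated forward differences commute with the Fréchet derivative. -/
theorem hasFDerivAt_fwdDiff_iter {E F : Type*} [NormedAddCommGroup E] [NormedSpace ℝ E]
    [NormedAddCommGroup F] [NormedSpace ℝ F] (h : E) (n : ℕ) {f : E → F} {f' : E → E →L[ℝ] F}
    (hf : ∀ x, HasFDerivAt f (f' x) x) (x : E) :
    HasFDerivAt ((fwdDiff h)^[n] f) ((fwdDiff h)^[n] f' x) x := by
  induction n generalizing f f' x with
  | zero => exact hf x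
  | succ n ih =>
    rw [Function.iterate_succ_apply, Function.iterate_succ_apply]
    exact ih (fun y => ((hasFDerivAt_comp_add_right h).2 (hf (y + h))).sub (hf y)) x

/-- The `n`-th forward difference of a smooth compactly supported function is `O(‖h‖ ^ n)`,
uniformly in the base point. -/
theorem exists_norm_fwdDiff_iter_le {E : Type} [NormedAddCommGroup E] [NormedSpace ℝ E]
    (n : ℕ) {F : Type} [NormedAddCommGroup F] [NormedSpace ℝ F] {f : E → F}
    (hf : ContDiff ℝ (⊤ : ℕ∞) f) (hc : HasCompactSupport f) :
    ∃ M : ℝ, ∀ h x, ‖(fwdDiff h)^[n] f x‖ ≤ M * ‖h‖ ^ n := by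
  induction n generalizing F with
  | zero =>
    obtain ⟨M, hM⟩ := hc.exists_bound_of_continuous hf.continuous
    exact ⟨M, fun h x => by simpa using hM x⟩
  | succ n ih =>
    obtain ⟨M, hM⟩ := ih (f := fderiv ℝ f)
      (hf.fderiv_right (by exact_mod_cast le_top)) (hc.fderiv ℝ)
    refine ⟨M, fun h x => ?_⟩
    rw [Function.iterate_succ_apply']
    have hd : ∀ y, HasFDerivAt f (fderiv ℝ f y) y := fun y =>
      (hf.differentiable (by simp) y).hasFDerivAt
    have := convex_univ.norm_image_sub_le_of_norm_hasFDerivWithin_le (𝕜 := ℝ)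
      (f := (fwdDiff h)^[n] f) (f' := (fwdDiff h)^[n] (fderiv ℝ f)) (C := M * ‖h‖ ^ n)
      (fun y _ => (hasFDerivAt_fwdDiff_iter h n hd y).hasFDerivWithinAt)
      (fun y _ => hM h y) (Set.mem_univ x) (Set.mem_univ (x + h))
    simpa [fwdDiff, pow_succ, mul_assoc] using this

theorem continuous_fwdDiff {E F : Type*} [NormedAddCommGroup E] [NormedAddCommGroup F]
    (h : E) {f : E → F} (hf : Continuous f) : Continuous (fwdDiff h f) := by
  unfold fwdDiff
  fun_prop

theorem eLpNorm_fwdDiff_iter_le {d : ℕ} (h : EuclideanSpace ℝ (Fin d)) (n : ℕ) {p : ℝ≥0∞}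
    (hp : 1 ≤ p) {f : EuclideanSpace ℝ (Fin d) → ℝ} (hf : Continuous f) :
    eLpNorm ((fwdDiff h)^[n] f) p volume ≤ 2 ^ n * eLpNorm f p volume := by
  induction n generalizing f with
  | zero => simp
  | succ n ih =>
    rw [Function.iterate_succ_apply]
    have h1 : eLpNorm (fun x => f (x + h)) p volume = eLpNorm f p volume :=
      eLpNorm_comp_measurePreserving (g := f) hf.aestronglyMeasurable
        (measurePreserving_add_right volume h)
    have h2 : eLpNorm (fwdDiff h f) p volume ≤ 2 * eLpNorm f p volume := by
      calc eLpNorm (fwdDiff h f) p volume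
          ≤ eLpNorm (fun x => f (x + h)) p volume + eLpNorm f p volume :=
            eLpNorm_sub_le (f := fun x => f (x + h))
              (by fun_prop : Continuous fun x => f (x + h)).aestronglyMeasurable
              hf.aestronglyMeasurable hp
        _ = 2 * eLpNorm f p volume := by rw [h1, two_mul]
    calc _ ≤ 2 ^ n * eLpNorm (fwdDiff h f) p volume := ih (continuous_fwdDiff h hf)
      _ ≤ 2 ^ n * (2 * eLpNorm f p volume) := by gcongr
      _ = _ := by rw [pow_succ, mul_assoc]

theorem finDiffOp_eq_fwdDiff_iter (d r : ℕ) (h : EuclideanSpace ℝ (Fin d))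
    (f : EuclideanSpace ℝ (Fin d) → ℝ) : finDiffOp d r h f = (fwdDiff h)^[r] f := by
  ext x
  rw [fwdDiff_iter_eq_sum_shift, finDiffOp]
  refine Finset.sum_congr rfl fun j _ => ?_
  rw [Nat.cast_smul_eq_nsmul, zsmul_eq_mul]
  push_cast
  rfl

/-- A smooth compactly supported function has finite Besov `B^s_{p,∞}` seminorm: its `r`-th
differences are `O(‖h‖ ^ s)` in `L^p` for `0 ≤ s ≤ r`. -/
theorem exists_eLpNorm_finDiffOp_le {d : ℕ} {r : ℕ} {s : ℝ} (hs : 0 ≤ s) (hsr : s ≤ r)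
    {p : ℝ≥0∞} (hp : 1 ≤ p) {f : EuclideanSpace ℝ (Fin d) → ℝ}
    (hf : ContDiff ℝ (⊤ : ℕ∞) f) (hc : HasCompactSupport f) :
    ∃ C : ℝ, 0 ≤ C ∧ ∀ h, eLpNorm (finDiffOp d r h f) p volume ≤ ENNReal.ofReal (C * ‖h‖ ^ s) := by
  obtain ⟨M, hM⟩ := exists_norm_fwdDiff_iter_le r hf hc
  obtain ⟨R, hR⟩ := hc.isCompact.isBounded.subset_closedBall (0 : EuclideanSpace ℝ (Fin d))
  set B := Metric.closedBall (0 : EuclideanSpace ℝ (Fin d)) (R + r) with hB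
  set V : ℝ := ((volume B) ^ (1 / p.toReal)).toReal with hV
  have hVt : (volume B) ^ (1 / p.toReal) ≠ ∞ :=
    ENNReal.rpow_ne_top_of_nonneg (by positivity) measure_closedBall_lt_top.ne
  have hft : eLpNorm f p volume ≠ ∞ :=
    (hf.continuous.memLp_of_hasCompactSupport hc).eLpNorm_ne_top
  set A : ℝ := (2 ^ r * eLpNorm f p volume).toReal with hA
  have hAt : 2 ^ r * eLpNorm f p volume ≠ ∞ := ENNReal.mul_ne_top (by simp) hft
  refine ⟨A + |M| * V, by positivity, fun h => ?_⟩
  rw [add_mul]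
  rcases le_total ‖h‖ 1 with hh | hh
  · have hle : ∀ x, ‖finDiffOp d r h f x‖ ≤ ‖B.indicator (fun _ => |M| * ‖h‖ ^ s) x‖ := by
      intro x
      by_cases hx : x ∈ B
      · rw [Set.indicator_of_mem hx, Real.norm_of_nonneg (r := |M| * ‖h‖ ^ s) (by positivity),
          finDiffOp_eq_fwdDiff_iter]
        refine (hM h x).trans ?_
        gcongr
        · exact le_abs_self M
        · rw [← Real.rpow_natCast]
          exact Real.rpow_le_rpow_of_exponent_ge' (norm_nonneg _) hh hs hsr
      · rw [Set.indicator_of_notMem hx]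
        have : finDiffOp d r h f x = 0 := by
          refine Finset.sum_eq_zero fun j hj => ?_
          have : f (x + (j : ℝ) • h) = 0 := by
            by_contra hne
            have h1 := hR (subset_tsupport f hne)
            rw [mem_closedBall_zero_iff] at h1
            refine hx (mem_closedBall_zero_iff.2 ?_)
            have hj' : (j : ℝ) ≤ r := by
              exact_mod_cast Nat.lt_succ_iff.1 (Finset.mem_range.1 hj)
            calc ‖x‖ = ‖x + (j : ℝ) • h - (j : ℝ) • h‖ := by simp
              _ ≤ ‖x + (j : ℝ) • h‖ + ‖(j : ℝ) • h‖ := norm_sub_le _ _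
              _ ≤ R + r := by
                rw [norm_smul, Real.norm_natCast]
                nlinarith [norm_nonneg h, (Nat.cast_nonneg j : (0 : ℝ) ≤ j)]
          rw [this, mul_zero]
        simp [this]
    calc eLpNorm (finDiffOp d r h f) p volume
        ≤ eLpNorm (B.indicator fun _ => |M| * ‖h‖ ^ s) p volume := eLpNorm_mono hle
      _ ≤ ‖|M| * ‖h‖ ^ s‖ₑ * volume B ^ (1 / p.toReal) := eLpNorm_indicator_const_le _ _
      _ = ENNReal.ofReal (|M| * V * ‖h‖ ^ s) := by
        rw [Real.enorm_of_nonneg (by positivity), ← ENNReal.ofReal_toReal hVt, ← hV,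
          ← ENNReal.ofReal_mul (by positivity), mul_right_comm]
      _ ≤ _ := ENNReal.ofReal_le_ofReal (le_add_of_nonneg_left (by positivity))
  · rw [finDiffOp_eq_fwdDiff_iter]
    calc _ ≤ 2 ^ r * eLpNorm f p volume := eLpNorm_fwdDiff_iter_le h r hp hf.continuous
      _ = ENNReal.ofReal A := (ENNReal.ofReal_toReal hAt).symm
      _ ≤ _ := by
        refine ENNReal.ofReal_le_ofReal ?_
        have h1 := Real.one_le_rpow hh hs
        have h2 : 0 ≤ |M| * V * ‖h‖ ^ s := by positivity
        have h3 : 0 ≤ A := by positivity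
        nlinarith

theorem eLpNorm_comp_inv_smul_sub {d : ℕ} {p : ℝ} (hp : 0 < p) {ρ : ℝ} (hρ : 0 < ρ)
    (a : EuclideanSpace ℝ (Fin d)) {F : Type*} [NormedAddCommGroup F]
    {g : EuclideanSpace ℝ (Fin d) → F} (hg : Continuous g) :
    eLpNorm (fun x => g (ρ⁻¹ • (x - a))) (ENNReal.ofReal p) volume =
      ENNReal.ofReal (ρ ^ (d / p)) * eLpNorm g (ENNReal.ofReal p) volume := by
  have h1 : eLpNorm (fun x => g (ρ⁻¹ • (x - a))) (ENNReal.ofReal p) volume =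
      eLpNorm (fun x => g (ρ⁻¹ • x)) (ENNReal.ofReal p) volume :=
    eLpNorm_comp_measurePreserving (g := fun x => g (ρ⁻¹ • x))
      (by fun_prop : Continuous fun x => g (ρ⁻¹ • x)).aestronglyMeasurable
      (measurePreserving_sub_right volume a)
  rw [h1]
  have h2 := eLpNorm_map_measure (p := ENNReal.ofReal p)
    (μ := (volume : Measure (EuclideanSpace ℝ (Fin d))))
    (f := fun x => ρ⁻¹ • x) (g := g) hg.aestronglyMeasurable
    (by fun_prop : Continuous fun x : EuclideanSpace ℝ (Fin d) => ρ⁻¹ • x).aemeasurable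
  rw [Measure.map_addHaar_smul _ (inv_ne_zero hρ.ne'),
    eLpNorm_smul_measure_of_ne_top ENNReal.ofReal_ne_top] at h2
  refine h2.symm.trans ?_
  rw [smul_eq_mul, finrank_euclideanSpace_fin, inv_pow, inv_inv, abs_of_pos (by positivity),
    one_div, ENNReal.toReal_inv, ENNReal.toReal_ofReal hp.le,
    ENNReal.ofReal_rpow_of_pos (by positivity), ← Real.rpow_natCast, ← Real.rpow_mul hρ.le,
    div_eq_mul_inv]

theorem finDiffOp_const_mul_comp_inv_smul_sub (d r : ℕ) (h a : EuclideanSpace ℝ (Fin d))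
    (ρ A : ℝ) (f : EuclideanSpace ℝ (Fin d) → ℝ) :
    finDiffOp d r h (fun x => A * f (ρ⁻¹ • (x - a))) =
      A • fun x => finDiffOp d r (ρ⁻¹ • h) f (ρ⁻¹ • (x - a)) := by
  ext x
  simp only [finDiffOp, Pi.smul_apply, smul_eq_mul, Finset.mul_sum]
  refine Finset.sum_congr rfl fun j _ => ?_
  have : ρ⁻¹ • (x + (j : ℝ) • h - a) = ρ⁻¹ • (x - a) + (j : ℝ) • ρ⁻¹ • h := by module
  rw [this]
  ring

/-- If `X` has fewer than `N ^ d` points, some cube of the regular grid of side `1 / N` in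
`[0,1)^d` contains no point of `X`. -/
theorem exists_grid_cube_disjoint {d N : ℕ} (X : Finset (EuclideanSpace ℝ (Fin d)))
    (hX : X.card < N ^ d) :
    ∃ a : Fin d → Fin N, ∀ x ∈ X, ∃ i, x i ∉ Set.Ico ((a i : ℝ) / N) (((a i : ℝ) + 1) / N) := by
  classical
  have hcard : (X.image fun x i => ⌊(N : ℝ) * x i⌋₊).card <
      (Finset.univ.image fun (a : Fin d → Fin N) i => (a i : ℕ)).card := by
    refine Finset.card_image_le.trans_lt ?_
    rw [Finset.card_image_of_injective]
    · simpa using hX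
    · intro a b hab
      ext i
      exact congrFun hab i
  obtain ⟨e, he, heX⟩ := Finset.exists_mem_notMem_of_card_lt_card hcard
  obtain ⟨a, -, rfl⟩ := Finset.mem_image.1 he
  refine ⟨a, fun x hx => ?_⟩
  by_contra! hcon
  refine heX (Finset.mem_image.2 ⟨x, hx, funext fun i => ?_⟩)
  have hN : (0 : ℝ) < N := by exact_mod_cast (a i).pos
  obtain ⟨h1, h2⟩ := hcon i
  rw [div_le_iff₀ hN] at h1
  rw [lt_div_iff₀ hN] at h2
  rw [Nat.floor_eq_iff]
  · constructor <;> linarith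
  · linarith [(Nat.cast_nonneg (a i : ℕ) : (0 : ℝ) ≤ _)]

theorem norm_gradient_eq_norm_fderiv {F : Type*} [NormedAddCommGroup F] [InnerProductSpace ℝ F]
    [CompleteSpace F] (f : F → ℝ) (x : F) : ‖gradient f x‖ = ‖fderiv ℝ f x‖ := by
  rw [gradient, LinearIsometryEquiv.norm_map]

theorem besovSeminorm_rescale_le {d r : ℕ} {s p C ρ : ℝ} (hp : 0 < p)
    (hC : 0 ≤ C) (hρ : 0 < ρ) (hs : 0 ≤ s) {f : EuclideanSpace ℝ (Fin d) → ℝ} (hf : Continuous f)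
    (hfC : ∀ h, eLpNorm (finDiffOp d r h f) (ENNReal.ofReal p) volume ≤
      ENNReal.ofReal (C * ‖h‖ ^ s)) (a : EuclideanSpace ℝ (Fin d)) :
    besovSeminorm d r s (ENNReal.ofReal p)
      (fun x => ρ ^ (s - d / p) * f (ρ⁻¹ • (x - a))) ≤ ENNReal.ofReal C := by
  refine iSup₂_le fun t ht => ?_
  rw [modulus]
  simp only [ENNReal.mul_iSup]
  refine iSup₂_le fun h hh => ?_
  have hcont : Continuous (finDiffOp d r (ρ⁻¹ • h) f) := by
    unfold finDiffOp
    fun_prop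
  rw [finDiffOp_const_mul_comp_inv_smul_sub, eLpNorm_const_smul,
    eLpNorm_comp_inv_smul_sub hp hρ a hcont, Real.enorm_of_nonneg (by positivity)]
  calc _ ≤ ENNReal.ofReal (t ^ (-s)) * (ENNReal.ofReal (ρ ^ (s - d / p)) *
        (ENNReal.ofReal (ρ ^ (d / p)) * ENNReal.ofReal (C * ‖ρ⁻¹ • h‖ ^ s))) := by
        gcongr
        exact hfC _
    _ = ENNReal.ofReal (t ^ (-s) * (ρ ^ (s - d / p) * (ρ ^ (d / p) * (C * ‖ρ⁻¹ • h‖ ^ s)))) := by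
        rw [← ENNReal.ofReal_mul (by positivity), ← ENNReal.ofReal_mul (by positivity),
          ← ENNReal.ofReal_mul (by positivity)]
    _ ≤ ENNReal.ofReal C := by
        refine ENNReal.ofReal_le_ofReal ?_
        rw [norm_smul, norm_inv, Real.norm_of_nonneg hρ.le,
          Real.mul_rpow (by positivity) (by positivity), Real.inv_rpow hρ.le,
          Real.rpow_sub hρ, Real.rpow_neg ht.le]
        have h1 : 0 < ρ ^ (d / p) := by positivity
        have h2 : 0 < ρ ^ s := by positivity
        have h3 : 0 < t ^ s := by positivity
        have h4 : ‖h‖ ^ s ≤ t ^ s := Real.rpow_le_rpow (norm_nonneg _) hh hs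
        have : (t ^ s)⁻¹ * (ρ ^ s / ρ ^ (d / p) * (ρ ^ (d / p) * (C * ((ρ ^ s)⁻¹ * ‖h‖ ^ s)))) =
            C * (‖h‖ ^ s / t ^ s) := by
          field_simp
        rw [this]
        exact mul_le_of_le_one_right hC ((div_le_one h3).2 h4)

theorem bump_lower_bound_interior (d : ℕ) (hd : 2 ≤ d) (γ : ℝ)
    (hγ : 1 / γ = 1 / 2 + 1 / (d : ℝ)) (p : ℝ) (hp1 : 1 ≤ p) (hpγ : p ≤ γ)
    (s : ℝ) (hs : (d : ℝ) / p < s) (r : ℕ) (hr : (s : ℝ) < r) :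
    ∃ C₀ c : ℝ, 0 < C₀ ∧ 0 < c ∧
      ∀ k : ℕ, ∀ X : Finset (EuclideanSpace ℝ (Fin d)),
        (∀ x ∈ X, ∀ i : Fin d, x i ∈ Set.Ioo (0 : ℝ) 1) →
        X.card = 2 ^ (k * d) →
        ∃ η v : EuclideanSpace ℝ (Fin d) → ℝ,
          Continuous η ∧ (∀ x, 0 ≤ η x) ∧
          (Function.support η ⊆ {x | ∀ i : Fin d, x i ∈ Set.Icc (0 : ℝ) 1}) ∧
          (∀ x ∈ X, η x = 0) ∧
          (eLpNorm η (ENNReal.ofReal p) volume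
            + besovSeminorm d r s (ENNReal.ofReal p) η ≤ ENNReal.ofReal C₀) ∧
          ContDiff ℝ 1 v ∧ (∀ x, 0 ≤ v x) ∧ HasCompactSupport v ∧
          (tsupport v ⊆ {x | ∀ i : Fin d, x i ∈ Set.Ioo (0 : ℝ) 1}) ∧
          (eLpNorm (fun x => ‖gradient v x‖) 2 volume ≤ 1) ∧
          c * ((2 ^ (k * d) : ℕ) : ℝ) ^ (-(s / d - 1 / p + 1 / γ)) ≤
            ∫ x, η x * v x := by
  have hp0 : 0 < p := by linarith
  have hs0 : 0 < s := lt_of_le_of_lt (by positivity) hs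
  have hd0 : (0 : ℝ) < d := by exact_mod_cast (by omega : 0 < d)
  let φ : ContDiffBump (0 : EuclideanSpace ℝ (Fin d)) :=
    ⟨1 / 8, 1 / 4, by norm_num, by norm_num⟩
  have hφ : ContDiff ℝ (⊤ : ℕ∞) φ := φ.contDiff
  have hφc : HasCompactSupport φ := φ.hasCompactSupport
  have hφ' : Continuous (fderiv ℝ φ) := hφ.continuous_fderiv (by simp)
  obtain ⟨C, hC, hfC⟩ := exists_eLpNorm_finDiffOp_le (p := ENNReal.ofReal p) hs0.le hr.le
    (by simpa using ENNReal.ofReal_le_ofReal hp1) hφ hφc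
  have hPt : eLpNorm φ (ENNReal.ofReal p) volume ≠ ∞ :=
    (hφ.continuous.memLp_of_hasCompactSupport hφc).eLpNorm_ne_top
  have hDt : eLpNorm (fderiv ℝ φ) 2 volume ≠ ∞ :=
    (hφ'.memLp_of_hasCompactSupport (hφc.fderiv ℝ)).eLpNorm_ne_top
  set P : ℝ := (eLpNorm φ (ENNReal.ofReal p) volume).toReal with hP
  set D : ℝ := (eLpNorm (fderiv ℝ φ) 2 volume).toReal with hD
  have hP0 : 0 ≤ P := ENNReal.toReal_nonneg
  have hD0 : 0 ≤ D := ENNReal.toReal_nonneg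
  set I : ℝ := ∫ x, φ x * φ x with hI
  have hI0 : 0 < I := by
    refine Continuous.integral_pos_of_hasCompactSupport_nonneg_nonzero (x := 0)
      (by fun_prop) hφc.mul_right (fun x => mul_self_nonneg _) ?_
    have : φ 0 = 1 := φ.one_of_mem_closedBall (Metric.mem_closedBall_self φ.rIn_pos.le)
    simp [this]
  set α : ℝ := s / d - 1 / p + 1 / γ with hα
  refine ⟨P + C + 1, (D + 1)⁻¹ * I * ((2 : ℝ) ^ (d : ℝ)) ^ (-α), by positivity, by positivity,
    fun k X _ hcard => ?_⟩
  obtain ⟨a, ha⟩ := exists_grid_cube_disjoint (N := 2 ^ (k + 1)) X (by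
    rw [hcard, ← pow_mul]
    exact Nat.pow_lt_pow_right (by norm_num) (by nlinarith))
  set ρ : ℝ := ((2 : ℝ) ^ (k + 1))⁻¹ with hρdef
  have hρ : 0 < ρ := by positivity
  have hρ1 : ρ ≤ 1 := inv_le_one_of_one_le₀ (one_le_pow₀ (by norm_num))
  have ha1 (i : Fin d) : ((a i : ℝ) + 1) * ρ ≤ 1 := by
    rw [hρdef, ← div_eq_mul_inv, div_le_one (by positivity)]
    exact_mod_cast (a i).isLt
  have ha0 (i : Fin d) : 0 ≤ (a i : ℝ) * ρ := by positivity
  set x₀ : EuclideanSpace ℝ (Fin d) := WithLp.toLp 2 fun i => ((a i : ℝ) + 1 / 2) * ρ with hx₀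
  have hcoord {x : EuclideanSpace ℝ (Fin d)} (hx : x ∈ Metric.closedBall x₀ (ρ / 4)) (i : Fin d) :
      (a i : ℝ) * ρ < x i ∧ x i < ((a i : ℝ) + 1) * ρ := by
    rw [mem_closedBall_iff_norm] at hx
    have h1 := (PiLp.norm_apply_le (x - x₀) i).trans hx
    rw [PiLp.sub_apply, Real.norm_eq_abs, abs_le] at h1
    simp only [hx₀] at h1
    constructor <;> nlinarith [h1.1, h1.2]
  have hcube {x : EuclideanSpace ℝ (Fin d)} (hx : x ∈ Metric.closedBall x₀ (ρ / 4)) (i : Fin d) :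
      x i ∈ Set.Ioo (0 : ℝ) 1 :=
    ⟨(ha0 i).trans_lt (hcoord hx i).1, (hcoord hx i).2.trans_le (ha1 i)⟩
  have hball {x : EuclideanSpace ℝ (Fin d)} (hx : φ (ρ⁻¹ • (x - x₀)) ≠ 0) :
      x ∈ Metric.closedBall x₀ (ρ / 4) := by
    have h1 : ρ⁻¹ • (x - x₀) ∈ Function.support φ := hx
    rw [φ.support_eq, mem_ball_zero_iff, norm_smul, norm_inv, Real.norm_of_nonneg hρ.le,
      inv_mul_lt_iff₀ hρ] at h1
    rw [mem_closedBall_iff_norm]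
    exact h1.le.trans (by simp [φ, div_eq_mul_inv])
  set B : ℝ := (D + 1)⁻¹ * ρ ^ (1 - d / 2 : ℝ) with hB
  have hB0 : 0 < B := by positivity
  have hsupp : Function.support (fun x => B * φ (ρ⁻¹ • (x - x₀))) ⊆
      Metric.closedBall x₀ (ρ / 4) := fun x hx => hball (right_ne_zero_of_mul hx)
  have hφρ : ContDiff ℝ (⊤ : ℕ∞) (fun x => φ (ρ⁻¹ • (x - x₀))) := by fun_prop
  refine ⟨fun x => ρ ^ (s - d / p) * φ (ρ⁻¹ • (x - x₀)), fun x => B * φ (ρ⁻¹ • (x - x₀)),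
    ?_, fun x => ?_, fun x hx i => ?_, fun x hx => ?_, ?_, ?_, fun x => ?_, ?_, ?_, ?_, ?_⟩
  · exact continuous_const.mul hφρ.continuous
  · have := φ.nonneg (x := ρ⁻¹ • (x - x₀))
    positivity
  · exact Set.Ioo_subset_Icc_self (hcube (hball (right_ne_zero_of_mul hx)) i)
  · by_contra hne
    obtain ⟨i, hi⟩ := ha x hx
    have h1 := hcoord (hball (right_ne_zero_of_mul hne)) i
    refine hi ?_
    push_cast
    rw [div_eq_mul_inv, div_eq_mul_inv]
    exact ⟨h1.1.le, h1.2⟩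
  · have h1 : eLpNorm (fun x => ρ ^ (s - d / p) * φ (ρ⁻¹ • (x - x₀))) (ENNReal.ofReal p) volume ≤
        ENNReal.ofReal P := by
      have h2 := eLpNorm_const_smul (ρ ^ (s - d / p)) (fun x => φ (ρ⁻¹ • (x - x₀)))
        (ENNReal.ofReal p) volume
      refine h2.le.trans ?_
      rw [eLpNorm_comp_inv_smul_sub hp0 hρ x₀ hφ.continuous, Real.enorm_of_nonneg (by positivity),
        ← mul_assoc, ← ENNReal.ofReal_mul (by positivity), ← Real.rpow_add hρ, sub_add_cancel,
        hP, ENNReal.ofReal_toReal hPt]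
      refine mul_le_of_le_one_left' ?_
      simpa using ENNReal.ofReal_le_ofReal (Real.rpow_le_one hρ.le hρ1 hs0.le)
    calc _ ≤ ENNReal.ofReal P + ENNReal.ofReal C :=
          add_le_add h1 (besovSeminorm_rescale_le hp0 hC hρ hs0.le hφ.continuous hfC x₀)
      _ = ENNReal.ofReal (P + C) := (ENNReal.ofReal_add hP0 hC).symm
      _ ≤ _ := ENNReal.ofReal_le_ofReal (by linarith)
  · exact contDiff_const.mul (hφρ.of_le (by exact_mod_cast le_top))
  · have := φ.nonneg (x := ρ⁻¹ • (x - x₀))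
    positivity
  · exact HasCompactSupport.of_support_subset_isCompact (isCompact_closedBall _ _) hsupp
  · exact fun x hx i => hcube (closure_minimal hsupp Metric.isClosed_closedBall hx) i
  · have h1 : (fun x => ‖gradient (fun x => B * φ (ρ⁻¹ • (x - x₀))) x‖) =
        (B * ρ⁻¹) • fun x => ‖fderiv ℝ φ (ρ⁻¹ • (x - x₀))‖ := by
      ext x
      rw [norm_gradient_eq_norm_fderiv, fderiv_const_mul (hφρ.differentiable (by simp) x),
        fderiv_comp_sub (f := fun x => φ (ρ⁻¹ • x)) x₀, fderiv_comp_smul, smul_smul,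
        norm_smul, Real.norm_of_nonneg (by positivity)]
      rfl
    rw [h1, eLpNorm_const_smul, eLpNorm_norm]
    have h2 := eLpNorm_comp_inv_smul_sub (p := 2) two_pos hρ x₀ hφ'
    rw [ENNReal.ofReal_ofNat] at h2
    rw [h2, Real.enorm_of_nonneg (by positivity), ← ENNReal.ofReal_toReal hDt, ← hD,
      ← ENNReal.ofReal_mul (by positivity), ← ENNReal.ofReal_mul (by positivity)]
    refine ENNReal.ofReal_le_one.2 ?_
    have h3 : B * ρ⁻¹ * (ρ ^ ((d : ℝ) / 2) * D) = (D + 1)⁻¹ * D := by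
      rw [hB, Real.rpow_sub hρ, Real.rpow_one]
      have : 0 < ρ ^ ((d : ℝ) / 2) := by positivity
      field_simp
    rw [h3, inv_mul_le_iff₀ (by positivity)]
    linarith
  · have h1 : ∫ x, (ρ ^ (s - d / p) * φ (ρ⁻¹ • (x - x₀))) * (B * φ (ρ⁻¹ • (x - x₀))) =
        ρ ^ (s - d / p) * B * (ρ ^ (d : ℝ) * I) := by
      have h2 : ∀ x, (ρ ^ (s - d / p) * φ (ρ⁻¹ • (x - x₀))) * (B * φ (ρ⁻¹ • (x - x₀))) =
          ρ ^ (s - d / p) * B * (φ (ρ⁻¹ • (x - x₀)) * φ (ρ⁻¹ • (x - x₀))) := fun x => by ring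
      simp only [h2]
      rw [integral_const_mul,
        integral_sub_right_eq_self (fun x => φ (ρ⁻¹ • x) * φ (ρ⁻¹ • x)) x₀,
        Measure.integral_comp_inv_smul volume (fun x => φ x * φ x), smul_eq_mul,
        finrank_euclideanSpace_fin, abs_of_pos (by positivity), Real.rpow_natCast]
    rw [h1]
    refine le_of_eq ?_
    have h3 : ρ ^ (s - d / p) * B * (ρ ^ (d : ℝ) * I) = (D + 1)⁻¹ * I * ρ ^ (d * α) := by
      have h4 : d * α = (s - d / p) + (1 - d / 2 : ℝ) + d := by
        rw [hα, hγ]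
        field_simp
        ring
      rw [h4, Real.rpow_add hρ, Real.rpow_add hρ, hB]
      ring
    have h5 : ρ ^ (d * α) = ((2 : ℝ) ^ (d : ℝ)) ^ (-α) * ((2 ^ (k * d) : ℕ) : ℝ) ^ (-α) := by
      push_cast
      rw [← Real.mul_rpow (by positivity) (by positivity), Real.rpow_natCast, ← pow_add,
        hρdef, Real.inv_rpow (by positivity), ← Real.rpow_neg (by positivity),
        ← Real.rpow_natCast, ← Real.rpow_natCast, ← Real.rpow_mul (by norm_num),
        ← Real.rpow_mul (by norm_num)]
      congr 1
      push_cast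
      ring
    rw [h3, h5]
    ring
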